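/- arXiv:1905.03364 — 7 statements merged into one kernel-verified Lean document; each statement's English description precedes it below -/
import Mathlib

section
/- Let k be a field, m ≥ 1, and let z_1, …, z_m be pairwise distinct elements of k. Set f := ∏_{i=1}^m (X − z_i) ∈ k[X]. Then for every j ∈ {1, …, m}, the second formal derivative of f satisfies f''(z_j) = 2 · f'(z_j) · ∑_{s ≠ j} (z_j − z_s)⁻¹ (the sum running over s ∈ {1,…,m} with s ≠ j). -/
open Polynomial Finset

/-- The logarithmic derivative of a product of linear factors, evaluated away from its roots. -/
theorem eval_derivative_prod_X_sub_C {k ι : Type*} [Field k] [DecidableEq ι] (S : Finset ι)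
    (z : ι → k) (x : k) (hx : ∀ s ∈ S, x - z s ≠ 0) :
    (derivative (∏ s ∈ S, (X - C (z s)))).eval x =
      (∏ s ∈ S, (X - C (z s))).eval x * ∑ s ∈ S, (x - z s)⁻¹ := by
  rw [derivative_prod_finset, eval_finsetSum, Finset.mul_sum]
  refine Finset.sum_congr rfl fun s hs => ?_
  rw [← Finset.mul_prod_erase S _ hs]
  simp only [derivative_X_sub_C, mul_one, eval_mul, eval_sub, eval_X, eval_C]
  field_simp [hx s hs]

theorem stmt0 {k : Type*} [Field k] {m : ℕ} (hm : 1 ≤ m) (z : Fin m → k)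
    (hz : Function.Injective z) (f : k[X]) (hf : f = ∏ i, (X - C (z i)))
    (j : Fin m) :
    (derivative (derivative f)).eval (z j) =
      2 * (derivative f).eval (z j) * ∑ s ∈ Finset.univ.erase j, (z j - z s)⁻¹ := by
  have hg := eval_derivative_prod_X_sub_C (Finset.univ.erase j) z (z j) fun s hs =>
    sub_ne_zero.mpr fun h => (Finset.ne_of_mem_erase hs) (hz h).symm
  rw [← Finset.mul_prod_erase Finset.univ _ (Finset.mem_univ j)] at hf
  generalize (∏ s ∈ Finset.univ.erase j, (X - C (z s))) = g at hf hg
  subst hf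
  simp only [derivative_mul, derivative_add, derivative_X_sub_C, one_mul, zero_mul,
    eval_add, eval_mul, eval_sub, eval_X, eval_C, sub_self, hg]
  ring
end

section
/- Let p be a prime, k a field of characteristic p, and a, b, c ∈ k with a·b − c ≠ 0. Set f := X^{p+1} + a·X^p + b·X + c ∈ k[X]. Then f is separable (i.e., f is coprime to its formal derivative f') and the second formal derivative f'' is the zero polynomial. -/
open Polynomial

theorem stmt2 {p : ℕ} (hp : p.Prime) {k : Type*} [Field k] [CharP k p]
    (a b c : k) (habc : a * b - c ≠ 0) (f : k[X])
    (hf : f = X ^ (p + 1) + C a * X ^ p + C b * X + C c) :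
    f.Separable ∧ derivative (derivative f) = 0 := by
  have hderiv : derivative f = X ^ p + C b := by
    simp [hf, derivative_X_pow]
  refine ⟨⟨-C (a * b - c)⁻¹, C (a * b - c)⁻¹ * (X + C a), ?_⟩, ?_⟩
  · have hinv : C (a * b - c)⁻¹ * (C a * C b - C c) = (1 : k[X]) := by
      rw [← C_mul, ← C_sub, ← C_mul, inv_mul_cancel₀ habc, C_1]
    rw [hderiv, hf]
    linear_combination hinv
  · simp [hderiv, derivative_X_pow]
end

section
/- Let p be an odd prime and k a field of characteristic p. For a polynomial g ∈ k[X], the second formal derivative g'' is the zero polynomial if and only if there exist polynomials P, Q ∈ k[X] such that g = P(X^p) + X · Q(X^p) (i.e., g(X) = P.comp(X^p) + X · Q.comp(X^p)); equivalently, the coefficient of X^i in g vanishes whenever i is congruent to neither 0 nor 1 modulo p. -/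
open Polynomial

theorem derivative_derivative_eq_zero_iff_coeff {p : ℕ} (hp : p.Prime) {k : Type*} [Field k]
    [CharP k p] (g : k[X]) :
    derivative (derivative g) = 0 ↔ ∀ i : ℕ, i % p ≠ 0 → i % p ≠ 1 → g.coeff i = 0 := by
  have hcoeff (n : ℕ) : (derivative (derivative g)).coeff n =
      g.coeff (n + 2) * ((n + 2 : ℕ) : k) * ((n + 1 : ℕ) : k) := by
    simp only [coeff_derivative]
    push_cast
    ring
  have h1 : 1 % p = 1 := Nat.mod_eq_of_lt hp.one_lt
  constructor
  · intro h i h0 h1'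
    obtain _ | _ | n := i
    · simp at h0
    · simp [h1] at h1'
    have hn := hcoeff n
    rw [h, coeff_zero] at hn
    rcases mul_eq_zero.mp hn.symm with hn | hn
    · rcases mul_eq_zero.mp hn with hn | hn
      · exact hn
      · exact absurd (Nat.mod_eq_zero_of_dvd ((CharP.cast_eq_zero_iff k p _).mp hn)) h0
    · have hd := Nat.mod_eq_zero_of_dvd ((CharP.cast_eq_zero_iff k p _).mp hn)
      refine absurd ?_ h1'
      rw [Nat.add_mod, hd, zero_add, Nat.mod_mod, h1]
  · intro h
    ext n
    rw [hcoeff, coeff_zero]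
    by_cases h0 : (n + 2) % p = 0
    · rw [(CharP.cast_eq_zero_iff k p (n + 2)).mpr (Nat.dvd_of_mod_eq_zero h0)]
      simp
    by_cases h1' : (n + 2) % p = 1
    · have hd : p ∣ n + 1 := by
        have hmod : 1 ≡ n + 2 [MOD p] := by rw [Nat.ModEq, h1, h1']
        simpa using (Nat.modEq_iff_dvd' (by omega)).mp hmod
      rw [(CharP.cast_eq_zero_iff k p (n + 1)).mpr hd, mul_zero]
    · rw [h _ h0 h1']
      simp

theorem exists_eq_comp_X_pow_add_X_mul_comp_X_pow_iff_coeff {p : ℕ} (hp : 1 < p)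
    {R : Type*} [CommSemiring R] (g : R[X]) :
    (∃ P Q : R[X], g = P.comp (X ^ p) + X * Q.comp (X ^ p)) ↔
      ∀ i : ℕ, i % p ≠ 0 → i % p ≠ 1 → g.coeff i = 0 := by
  have hp0 : 0 < p := by omega
  have h1 : 1 % p = 1 := Nat.mod_eq_of_lt hp
  simp only [← expand_eq_comp_X_pow]
  constructor
  · rintro ⟨P, Q, rfl⟩ i h0 h1'
    obtain _ | n := i
    · simp at h0
    have hn : ¬ p ∣ n := fun hd => h1' (by
      rw [Nat.add_mod, Nat.mod_eq_zero_of_dvd hd, zero_add, Nat.mod_mod, h1])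
    rw [coeff_add, coeff_X_mul, coeff_expand hp0, coeff_expand hp0, if_neg hn,
      if_neg fun hd => h0 (Nat.mod_eq_zero_of_dvd hd), add_zero]
  · intro h
    have hexp (f : R[X]) (n : ℕ) :
        (expand R p (contract p f)).coeff n = if p ∣ n then f.coeff n else 0 := by
      rw [coeff_expand hp0]
      split_ifs with hd
      · rw [coeff_contract hp0.ne', Nat.div_mul_cancel hd]
      · rfl
    refine ⟨contract p g, contract p g.divX, ?_⟩
    ext n
    obtain _ | n := n
    · simp [hexp]
    rw [coeff_add, coeff_X_mul, hexp, hexp, coeff_divX]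
    by_cases hd : p ∣ n
    · have hd' : ¬ p ∣ n + 1 := fun hd' => by
        have := Nat.le_of_dvd one_pos ((Nat.dvd_add_right hd).mp hd')
        omega
      rw [if_pos hd, if_neg hd', zero_add]
    · rw [if_neg hd, add_zero]
      split_ifs with hd'
      · rfl
      refine h _ (fun h0 => hd' (Nat.dvd_of_mod_eq_zero h0)) fun h1' => hd ?_
      have hmod : 1 ≡ n + 1 [MOD p] := by rw [Nat.ModEq, h1, h1']
      simpa using (Nat.modEq_iff_dvd' (by omega)).mp hmod

theorem stmt5 {p : ℕ} (hp : p.Prime) (hodd : Odd p) {k : Type*} [Field k]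
    [CharP k p] (g : k[X]) :
    (derivative (derivative g) = 0 ↔
      ∃ P Q : k[X], g = P.comp (X ^ p) + X * Q.comp (X ^ p)) ∧
    (derivative (derivative g) = 0 ↔
      ∀ i : ℕ, i % p ≠ 0 → i % p ≠ 1 → g.coeff i = 0) :=
  ⟨(derivative_derivative_eq_zero_iff_coeff hp g).trans
    (exists_eq_comp_X_pow_add_X_mul_comp_X_pow_iff_coeff hp.one_lt g).symm,
    derivative_derivative_eq_zero_iff_coeff hp g⟩
end

section
/- Let p be a prime, k a field of characteristic p, h ∈ k[X] a polynomial whose second formal derivative h'' is zero and whose natural degree d := natDegree(h) is divisible by p, and γ ∈ k an element with h(γ) ≠ 0. Define g := h(X + γ) (composition of h with X + γ) and f := X · reverse(g) ∈ k[X], where reverse(g) is the polynomial with the coefficients of g written in reverse order. Then natDegree(f) = d + 1 and the second formal derivative f'' is the zero polynomial. -/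
open Polynomial

theorem Polynomial.natCast_mul_sub_one_mul_coeff_eq_zero {R : Type*} [CommRing R] {g : R[X]}
    (hg : derivative (derivative g) = 0) (m : ℕ) : (m : R) * (m - 1) * g.coeff m = 0 := by
  match m with
  | 0 => simp
  | 1 => simp
  | n + 2 =>
    have key := congrArg (fun q => q.coeff n) hg
    simp only [coeff_derivative, coeff_zero] at key
    push_cast at key ⊢
    linear_combination key

theorem Polynomial.derivative_derivative_X_mul_reverse_eq_zero {R : Type*} [CommRing R] {g : R[X]}
    (hg : derivative (derivative g) = 0) (hd : (g.natDegree : R) = 0) :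
    derivative (derivative (X * g.reverse)) = 0 := by
  ext n
  simp only [coeff_derivative, coeff_zero, coeff_X_mul, coeff_reverse]
  obtain hn | hn := le_or_gt (n + 1) g.natDegree
  · rw [revAt_le hn]
    obtain ⟨m, hm⟩ := Nat.exists_eq_add_of_le hn
    have hsum : (n : R) + 1 + m = 0 := by rw [← hd, hm]; push_cast; rfl
    have hn' : (n : R) = -1 - m := by linear_combination hsum
    rw [show g.natDegree - (n + 1) = m by lia]
    push_cast
    rw [hn']
    linear_combination natCast_mul_sub_one_mul_coeff_eq_zero hg m
  · rw [revAt_eq_self_of_lt hn, coeff_eq_zero_of_natDegree_lt hn]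
    simp

theorem stmt7 {p : ℕ} (hp : p.Prime) {k : Type*} [Field k] [CharP k p]
    (h : k[X]) (hh : derivative (derivative h) = 0) (d : ℕ)
    (hd : d = h.natDegree) (hpd : p ∣ d) (γ : k) (hγ : h.eval γ ≠ 0)
    (g f : k[X]) (hg : g = h.comp (X + C γ)) (hf : f = X * g.reverse) :
    f.natDegree = d + 1 ∧ derivative (derivative f) = 0 := by
  have hgd : g.natDegree = d := by simp [hg, hd, natDegree_comp]
  have hg0 : g.coeff 0 ≠ 0 := by simpa [hg, coeff_zero_eq_eval_zero, eval_comp] using hγ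
  have hgne : g ≠ 0 := by rintro rfl; simp at hg0
  have hg2 : derivative (derivative g) = 0 := by simp [hg, derivative_comp, hh]
  subst hf
  constructor
  · rw [natDegree_X_mul (by simpa using hgne), reverse_natDegree,
      natTrailingDegree_eq_zero.2 (Or.inr hg0), hgd, Nat.sub_zero]
  · refine derivative_derivative_X_mul_reverse_eq_zero hg2 ?_
    rw [hgd]
    exact (CharP.cast_eq_zero_iff k p d).2 hpd
end

section
/- Let k be a field, h ∈ k[X] a separable polynomial (i.e., coprime to its formal derivative), and γ ∈ k an element with h(γ) ≠ 0. Define g := h(X + γ) and f := X · reverse(g) ∈ k[X], where reverse(g) is the polynomial with the coefficients of g written in reverse order. Then f is separable. -/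
open Polynomial

theorem X_mul_derivative_reverse_add {R : Type*} [CommRing R] (g : R[X]) :
    X * derivative g.reverse + reflect g.natDegree (X * derivative g) =
      (g.natDegree : R[X]) * g.reverse := by
  have coeff_euler : ∀ (p : R[X]) (n : ℕ), (X * derivative p).coeff n = n * p.coeff n := by
    intro p n
    cases n with
    | zero => simp
    | succ n => rw [coeff_X_mul, coeff_derivative]; push_cast; ring
  ext i
  rw [coeff_add, coeff_euler, coeff_reflect, coeff_euler, coeff_natCast_mul, coeff_reverse]
  rcases le_or_gt i g.natDegree with hi | hi
  · rw [revAt_le hi, Nat.cast_sub hi]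
    ring
  · rw [revAt_eq_self_of_lt hi, coeff_eq_zero_of_natDegree_lt hi]
    simp

theorem isCoprime_X_reverse {k : Type*} [Field k] {g : k[X]} (hg : g ≠ 0) :
    IsCoprime X g.reverse := by
  rw [irreducible_X.coprime_iff_not_dvd, X_dvd_iff, coeff_zero_reverse]
  exact leadingCoeff_ne_zero.mpr hg

theorem Polynomial.Separable.reverse {k : Type*} [Field k] {g : k[X]} (hg : g.Separable) :
    g.reverse.Separable := by
  obtain ⟨a, b, hab⟩ := hg
  set d := g.natDegree with hd
  set m := max (X * a).natDegree b.natDegree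
  have hdeg : (X * derivative g).natDegree ≤ d := by
    rcases Nat.eq_zero_or_pos d with h0 | hpos
    · rw [derivative_of_natDegree_zero h0]
      simp
    · have h1 := natDegree_mul_le (p := (X : k[X])) (q := derivative g)
      have h2 := natDegree_derivative_lt hpos.ne'
      rw [natDegree_X] at h1
      omega
  have hX : (X * a) * g + b * (X * derivative g) = X ^ 1 := by
    linear_combination X * hab
  have hrefl : reflect m (X * a) * g.reverse + reflect m b * reflect d (X * derivative g) =
      X ^ revAt (m + d) 1 := by
    rw [← reflect_monomial, ← hX, reflect_add, reflect_mul _ _ (le_max_left _ _) hd.ge,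
      reflect_mul _ _ (le_max_right _ _) hdeg]
    rfl
  have hcop : IsCoprime (X ^ revAt (m + d) 1) g.reverse :=
    (isCoprime_X_reverse (Separable.ne_zero ⟨a, b, hab⟩)).pow_left
  obtain ⟨u, v, huv⟩ := hcop
  refine ⟨u * (reflect m (X * a) + reflect m b * (d : k[X])) + v, -(u * reflect m b * X), ?_⟩
  linear_combination huv + u * hrefl - u * reflect m b * X_mul_derivative_reverse_add g

theorem Polynomial.Separable.comp_X_add_C {R : Type*} [CommRing R] {h : R[X]}
    (hsep : h.Separable) (γ : R) : (h.comp (X + C γ)).Separable := by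
  have key := IsCoprime.map hsep (compRingHom (X + C γ))
  simpa [Separable, derivative_comp] using key

theorem stmt8 {k : Type*} [Field k] (h : k[X]) (hsep : h.Separable)
    (γ : k) (hγ : h.eval γ ≠ 0) (g f : k[X])
    (hg : g = h.comp (X + C γ)) (hf : f = X * g.reverse) :
    f.Separable := by
  have hgsep : g.Separable := hg ▸ hsep.comp_X_add_C γ
  rw [hf]
  exact separable_X.mul hgsep.reverse (isCoprime_X_reverse hgsep.ne_zero)
end

section
/- Let p be a prime with p ≥ 3 and k an algebraically closed field of characteristic p. Let h ∈ k[X] be a separable polynomial with zero second formal derivative h'' = 0, whose degree d := natDegree(h) is positive and divisible by p, and let γ ∈ k satisfy h(γ) ≠ 0. Then h has d pairwise distinct roots z_1, …, z_d in k, none equal to γ; the d + 1 elements 0, (z_1 − γ)⁻¹, …, (z_d − γ)⁻¹ of k are pairwise distinct; and these d + 1 elements satisfy the Bethe ansatz equations: for each element v among them, ∑_w (v − w)⁻¹ = 0, where the sum runs over the other d elements w of this collection. -/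
open Polynomial Finset

/-- Roots of a split separable polynomial with vanishing second derivative satisfy the
Bethe ansatz equations. -/
theorem sum_inv_sub_roots_eq_zero {k : Type*} [Field k] [DecidableEq k] (h2 : (2 : k) ≠ 0)
    {h : k[X]} (hs : h.Splits) (hsep : h.Separable) (hh : derivative (derivative h) = 0)
    {z : k} (hz : z ∈ h.roots.toFinset) :
    ∑ w ∈ h.roots.toFinset.erase z, (z - w)⁻¹ = 0 := by
  have h0 : h ≠ 0 := hsep.ne_zero
  have hnd : h.roots.Nodup := nodup_roots hsep
  have hroot : h.IsRoot z := (mem_roots h0).1 (Multiset.mem_toFinset.1 hz)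
  obtain ⟨g, rfl⟩ := dvd_iff_isRoot.2 hroot
  have hg0 : g ≠ 0 := right_ne_zero_of_mul h0
  have hgs : g.Splits := hs.of_dvd h0 (dvd_mul_left _ _)
  rw [roots_mul h0, roots_X_sub_C, Multiset.singleton_add, Multiset.nodup_cons] at hnd
  have hgz : g.eval z ≠ 0 := fun e => hnd.1 ((mem_roots hg0).2 e)
  have hder : (derivative g).eval z = 0 := by
    have e := congrArg (eval z) hh
    simp only [derivative_mul, derivative_sub, derivative_X, derivative_C, derivative_add,
      eval_add, eval_mul, eval_sub, eval_X, eval_C, eval_zero, sub_zero, sub_self, zero_mul,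
      one_mul, add_zero] at e
    refine (mul_eq_zero.1 (?_ : 2 * (derivative g).eval z = 0)).resolve_left h2
    linear_combination e
  have key := hgs.eval_derivative_div_eval_of_ne_zero hgz
  rw [hder, zero_div] at key
  have hset : ((X - C z) * g).roots.toFinset.erase z = g.roots.toFinset := by
    rw [roots_mul h0, roots_X_sub_C, Multiset.singleton_add, Multiset.toFinset_cons,
      Finset.erase_insert (by simpa using hnd.1)]
  rw [hset, key, Finset.sum_multiset_map_count]
  refine Finset.sum_congr rfl fun w hw => ?_
  rw [Multiset.count_eq_one_of_mem hnd.2 (Multiset.mem_toFinset.1 hw), one_smul, one_div]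

/-- In characteristic `p ≥ 3`, a polynomial of degree divisible by `p` with vanishing second
derivative has vanishing subleading coefficient. -/
theorem nextCoeff_eq_zero_of_derivative_derivative_eq_zero {k : Type*} [Field k] {p : ℕ}
    [CharP k p] (hp3 : 3 ≤ p) (h2 : (2 : k) ≠ 0) {h : k[X]}
    (hh : derivative (derivative h) = 0) (hpos : 0 < h.natDegree) (hpd : p ∣ h.natDegree) :
    h.nextCoeff = 0 := by
  have hd3 : 3 ≤ h.natDegree := hp3.trans (Nat.le_of_dvd hpos hpd)
  have hcast : (h.natDegree : k) = 0 := (CharP.cast_eq_zero_iff k p _).2 hpd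
  obtain ⟨n, hn⟩ := Nat.exists_eq_add_of_le' hd3
  have e := congrArg (fun q => coeff q n) hh
  simp only [coeff_derivative, coeff_zero] at e
  rw [nextCoeff_of_natDegree_pos hpos]
  rw [hn] at hcast ⊢
  push_cast at hcast e
  have hn3 : (n : k) = -3 := by linear_combination hcast
  rw [hn3] at e
  refine (mul_eq_zero.1 (?_ : 2 * h.coeff (n + 3 - 1) = 0)).resolve_left h2
  rw [show n + 3 - 1 = n + 1 + 1 by omega]
  linear_combination e

theorem stmt9 {p : ℕ} (hp : p.Prime) (hp3 : 3 ≤ p) {k : Type*} [Field k]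
    [IsAlgClosed k] [CharP k p] [DecidableEq k]
    (h : k[X]) (hsep : h.Separable) (hh : derivative (derivative h) = 0)
    (d : ℕ) (hd : d = h.natDegree) (hdpos : 0 < d) (hpd : p ∣ d)
    (γ : k) (hγ : h.eval γ ≠ 0) :
    Multiset.card h.roots = d ∧ h.roots.Nodup ∧ γ ∉ h.roots ∧
      (insert (0 : k) (h.roots.toFinset.image fun z => (z - γ)⁻¹)).card = d + 1 ∧
      ∀ v ∈ insert (0 : k) (h.roots.toFinset.image fun z => (z - γ)⁻¹),
        ∑ w ∈ (insert (0 : k) (h.roots.toFinset.image fun z => (z - γ)⁻¹)).erase v,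
          (v - w)⁻¹ = 0 := by
  have h2 : (2 : k) ≠ 0 := by
    intro e
    have : p ∣ 2 := (CharP.cast_eq_zero_iff k p 2).1 (by exact_mod_cast e)
    have := Nat.le_of_dvd two_pos this
    omega
  have hs : h.Splits := IsAlgClosed.splits h
  have hcard : Multiset.card h.roots = d := by rw [hd, hs.natDegree_eq_card_roots]
  have hnd : h.roots.Nodup := nodup_roots hsep
  have hγr : γ ∉ h.roots := fun hm => hγ (isRoot_of_mem_roots hm)
  have hdk : (d : k) = 0 := (CharP.cast_eq_zero_iff k p _).2 hpd
  have hScard : h.roots.toFinset.card = d := by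
    rw [Multiset.toFinset_card_of_nodup hnd, hcard]
  have hsum : ∑ z ∈ h.roots.toFinset, z = 0 := by
    have e := hs.nextCoeff_eq_neg_sum_roots_mul_leadingCoeff
    rw [nextCoeff_eq_zero_of_derivative_derivative_eq_zero hp3 h2 hh (hd ▸ hdpos) (hd ▸ hpd)] at e
    have e' : h.roots.sum = 0 := by
      have := leadingCoeff_ne_zero.2 hsep.ne_zero
      simpa [this] using e.symm
    rw [Finset.sum_multiset_count] at e'
    rw [← e']
    refine Finset.sum_congr rfl fun w hw => ?_
    rw [Multiset.count_eq_one_of_mem hnd (Multiset.mem_toFinset.1 hw), one_smul]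
  have hbethe := fun z hz => sum_inv_sub_roots_eq_zero h2 hs hsep hh (z := z) hz
  have hγS : ∀ z ∈ h.roots.toFinset, z - γ ≠ 0 := fun z hz e =>
    hγr (sub_eq_zero.1 e ▸ Multiset.mem_toFinset.1 hz)
  refine ⟨hcard, hnd, hγr, ?_⟩
  generalize h.roots.toFinset = S at *
  have hinj : Function.Injective fun z : k => (z - γ)⁻¹ :=
    inv_injective.comp (sub_left_injective)
  have h0 : (0 : k) ∉ S.image fun z => (z - γ)⁻¹ := by
    intro hm
    obtain ⟨z, hz, e⟩ := Finset.mem_image.1 hm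
    exact hγS z hz (inv_eq_zero.1 e)
  refine ⟨by rw [Finset.card_insert_of_notMem h0, Finset.card_image_of_injective _ hinj, hScard],
    fun v hv => ?_⟩
  rcases Finset.mem_insert.1 hv with rfl | hv
  · rw [Finset.erase_insert h0, Finset.sum_image hinj.injOn]
    simp only [zero_sub, inv_neg, inv_inv, Finset.sum_neg_distrib, Finset.sum_sub_distrib, hsum,
      Finset.sum_const, hScard, nsmul_eq_mul, hdk, zero_mul, sub_zero, neg_zero]
  · obtain ⟨z, hz, rfl⟩ := Finset.mem_image.1 hv
    have ha := hγS z hz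
    rw [Finset.erase_insert_of_ne (inv_ne_zero ha).symm, ← Finset.image_erase hinj,
      Finset.sum_insert (fun hm => h0 (Finset.image_subset_image (Finset.erase_subset _ _) hm)),
      Finset.sum_image hinj.injOn, sub_zero, inv_inv]
    have hterm : ∀ w ∈ S.erase z, ((z - γ)⁻¹ - (w - γ)⁻¹)⁻¹ =
        (z - γ) - (z - γ) ^ 2 * (z - w)⁻¹ := by
      intro w hw
      obtain ⟨hwz, hw⟩ := Finset.mem_erase.1 hw
      have hb := hγS w hw
      have hzw : z - w ≠ 0 := sub_ne_zero.2 hwz.symm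
      rw [inv_sub_inv ha hb, inv_div, sub_sub_sub_cancel_right, ← neg_sub z w]
      field_simp
      ring
    rw [Finset.sum_congr rfl hterm, Finset.sum_sub_distrib, ← Finset.mul_sum, hbethe z hz,
      Finset.sum_const, nsmul_eq_mul, mul_zero, sub_zero]
    have hc : ((S.erase z).card : k) + 1 = 0 := by
      rw [← hdk, ← hScard, ← Finset.card_erase_add_one hz, Nat.cast_succ]
    linear_combination (z - γ) * hc
end

section
/- Let p be a prime with p ≥ 3, k an algebraically closed field of characteristic p, and l a positive integer. Then there exist pairwise distinct elements z_1, …, z_{lp+1} of k satisfying the Bethe ansatz equations: for every j ∈ {1, …, lp+1}, ∑_{s ≠ j} (z_j − z_s)⁻¹ = 0. -/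
open Finset

/-- For an `n`-th root of unity `a`, the reflection `w ↦ a ^ 2 / w` of the `n`-th roots of unity
shows that twice the sum of the `(a - w)⁻¹` over the `w ≠ a` is `(n - 1) / a`. -/
theorem two_mul_sum_inv_sub_nthRootsFinset {k : Type*} [Field k] [DecidableEq k] {n : ℕ}
    (hn : 0 < n) {a : k} (ha : a ∈ Polynomial.nthRootsFinset n (1 : k)) :
    2 * ∑ w ∈ (Polynomial.nthRootsFinset n (1 : k)).erase a, (a - w)⁻¹ =
      ((Polynomial.nthRootsFinset n (1 : k)).card - 1 : ℕ) * a⁻¹ := by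
  have ne_zero_of_mem {w : k} (hw : w ∈ Polynomial.nthRootsFinset n (1 : k)) : w ≠ 0 :=
    Polynomial.ne_zero_of_mem_nthRootsFinset one_ne_zero hw
  have ha0 := ne_zero_of_mem ha
  have maps : ∀ w ∈ (Polynomial.nthRootsFinset n (1 : k)).erase a,
      a ^ 2 / w ∈ (Polynomial.nthRootsFinset n (1 : k)).erase a := by
    intro w hw
    obtain ⟨hwa, hw⟩ := Finset.mem_erase.1 hw
    have hw0 := ne_zero_of_mem hw
    rw [Polynomial.mem_nthRootsFinset hn] at hw ha
    refine Finset.mem_erase.2 ⟨fun h => hwa ?_, ?_⟩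
    · rw [div_eq_iff hw0, pow_two] at h
      exact (mul_left_cancel₀ ha0 h).symm
    · rw [Polynomial.mem_nthRootsFinset hn, div_pow, ← pow_mul, mul_comm, pow_mul, ha, hw]
      simp
  have invol : ∀ w ∈ (Polynomial.nthRootsFinset n (1 : k)).erase a, a ^ 2 / (a ^ 2 / w) = w :=
    fun w _ => div_div_cancel₀ (pow_ne_zero 2 ha0)
  have reflect : ∑ w ∈ (Polynomial.nthRootsFinset n (1 : k)).erase a, (a - w)⁻¹ =
      ∑ w ∈ (Polynomial.nthRootsFinset n (1 : k)).erase a, (a - a ^ 2 / w)⁻¹ :=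
    Finset.sum_nbij' (fun w => a ^ 2 / w) (fun w => a ^ 2 / w) maps maps invol invol
      fun w hw => by rw [invol w hw]
  rw [two_mul]
  nth_rewrite 2 [reflect]
  rw [← Finset.sum_add_distrib, ← Finset.card_erase_of_mem ha, ← nsmul_eq_mul]
  refine Finset.sum_eq_card_nsmul fun w hw => ?_
  obtain ⟨hwa, hw⟩ := Finset.mem_erase.1 hw
  have hw0 := ne_zero_of_mem hw
  have h1 : a - w ≠ 0 := sub_ne_zero.2 hwa.symm
  have h2 : w - a ≠ 0 := sub_ne_zero.2 hwa
  have h3 : a - a ^ 2 / w = a * (w - a) / w := by field_simp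
  rw [h3, inv_div]
  field_simp
  ring

theorem stmt10 {p : ℕ} (hp : p.Prime) (hp3 : 3 ≤ p) {k : Type*} [Field k]
    [IsAlgClosed k] [CharP k p] (l : ℕ) (hl : 0 < l) :
    ∃ z : Fin (l * p + 1) → k, Function.Injective z ∧
      ∀ j, ∑ s ∈ Finset.univ.erase j, (z j - z s)⁻¹ = 0 := by
  classical
  have : NeZero ((l * p + 1 : ℕ) : k) := ⟨by simp⟩
  obtain ⟨ζ, hζ⟩ := HasEnoughRootsOfUnity.exists_primitiveRoot k (l * p + 1)
  have card_roots := hζ.card_nthRootsFinset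
  let e := (Finset.equivFinOfCardEq card_roots).symm
  refine ⟨fun i => e i, Subtype.val_injective.comp e.injective, fun j => ?_⟩
  have sum_eq : ∑ s ∈ Finset.univ.erase j, ((e j : k) - e s)⁻¹ =
      ∑ w ∈ (Polynomial.nthRootsFinset (l * p + 1) (1 : k)).erase (e j), ((e j : k) - w)⁻¹ := by
    refine Finset.sum_bij (fun s _ => (e s : k)) ?_ ?_ ?_ fun _ _ => rfl
    · intro s hs
      exact Finset.mem_erase.2 ⟨fun h => (Finset.mem_erase.1 hs).1
        (e.injective (Subtype.ext h)), (e s).2⟩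
    · exact fun s _ t _ h => e.injective (Subtype.ext h)
    · intro w hw
      obtain ⟨hwj, hw⟩ := Finset.mem_erase.1 hw
      refine ⟨e.symm ⟨w, hw⟩, Finset.mem_erase.2 ⟨fun h => hwj ?_, Finset.mem_univ _⟩, by simp⟩
      rw [← h, e.apply_symm_apply]
  have h_two : (2 : k) ≠ 0 := by
    intro h
    have : p ∣ 2 := (CharP.cast_eq_zero_iff k p 2).1 (by exact_mod_cast h)
    exact absurd (Nat.le_of_dvd two_pos this) (by omega)
  have key := two_mul_sum_inv_sub_nthRootsFinset (Nat.succ_pos (l * p)) (e j).2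
  rw [Nat.succ_eq_add_one, card_roots, Nat.add_sub_cancel, Nat.cast_mul, CharP.cast_eq_zero k p,
    mul_zero, zero_mul] at key
  exact sum_eq.trans ((mul_eq_zero.1 key).resolve_left h_two)
end
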